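/- Let l_i(r), for 1 ≤ i ≤ n and 1 ≤ r ≤ R, be isometries with mutually orthogonal ranges (l_i(r)* l_j(s) = δ_{ij} δ_{rs} 1) in a unital C*-algebra, and let b_i, c_j be elements of a C*-algebra A. Then ‖Σ_{r,i,j} l_i(r) l_j(r) ⊗ b_i c_j‖ ≤ R^{1/2} Σ_i ‖b_i‖‖c_i‖ (with indices paired as in the sum Σ_i ‖b_i‖‖c_i‖ when ‖b_i‖ = ‖c_i‖), and ‖Σ_{r,i,j} l_i(r) l_j(r)* ⊗ b_i c_j‖ = max_r ‖Σ_{i,j} l_i(r) l_j(r)* ⊗ b_i c_j‖ ≤ Σ_i ‖b_i‖‖c_i‖. -/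

import Mathlib

open scoped Function in
theorem aux_norm_sum {C : Type*} [CStarAlgebra C] {R : ℕ} (hR : 0 < R) (T : Fin R → C)
    (h1 : ∀ r s, r ≠ s → star (T r) * T s = 0) (h2 : ∀ r s, r ≠ s → T r * star (T s) = 0) :
    ‖∑ r, T r‖ = ⨆ r, ‖T r‖ := by
  have : Nonempty (Fin R) := ⟨⟨0, hR⟩⟩
  have hbdd : BddAbove (Set.range fun r => ‖T r‖) := Set.finite_range _ |>.bddAbove
  have hM : 0 ≤ ⨆ r, ‖T r‖ := Real.iSup_nonneg fun r => norm_nonneg _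
  have hsum : star (∑ r, T r) * (∑ r, T r) = ∑ r, star (T r) * T r := by
    rw [star_sum, Finset.sum_mul]
    refine Finset.sum_congr rfl fun r _ => ?_
    rw [Finset.mul_sum]
    exact Finset.sum_eq_single r (fun s _ hs => h1 r s hs.symm) (by simp)
  apply le_antisymm
  · have key := IsSelfAdjoint.nnnorm_sum_eq_sup (f := fun r => star (T r) * T r) Finset.univ
      (fun r _ => IsSelfAdjoint.star_mul_self _) (by
        intro r s hrs
        change star (T r) * T r * (star (T s) * T s) = 0
        rw [mul_assoc, ← mul_assoc (T r), h2 r s hrs, zero_mul, mul_zero])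
    obtain ⟨r, -, hr⟩ := Finset.exists_mem_eq_sup (Finset.univ : Finset (Fin R))
      Finset.univ_nonempty (fun r => ‖star (T r) * T r‖₊)
    rw [hr, ← hsum, CStarRing.nnnorm_star_mul_self, CStarRing.nnnorm_star_mul_self] at key
    have keyR : ‖∑ r, T r‖ * ‖∑ r, T r‖ = ‖T r‖ * ‖T r‖ := congrArg NNReal.toReal key
    have h3 := (mul_self_inj (norm_nonneg _) (norm_nonneg _)).1 keyR
    rw [h3]
    exact le_ciSup hbdd r
  · refine ciSup_le fun r => ?_
    have h : star (T r) * (∑ s, T s) = star (T r) * T r := by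
      rw [Finset.mul_sum]
      exact Finset.sum_eq_single r (fun s _ hs => h1 r s hs.symm) (by simp)
    have hle : ‖T r‖ * ‖T r‖ ≤ ‖T r‖ * ‖∑ s, T s‖ := by
      rw [← CStarRing.norm_star_mul_self, ← h]
      exact (norm_mul_le _ _).trans (by rw [norm_star])
    rcases (norm_nonneg (T r)).eq_or_lt with h0 | h0
    · rw [← h0]; exact norm_nonneg _
    · exact le_of_mul_le_mul_left hle h0

/-- Inner products of the columns. -/
theorem aux_col {C : Type*} [CStarAlgebra C] {n R : ℕ} (L : Fin R → Fin n → C)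
    (hL : ∀ r s i j, star (L r i) * L s j = if r = s ∧ i = j then 1 else 0) (u : Fin n → C)
    (r s : Fin R) :
    star (∑ i, L r i * u i) * (∑ i, L s i * u i) =
      if r = s then ∑ i, star (u i) * u i else 0 := by
  have h : ∀ i j, star (u i) * star (L r i) * (L s j * u j) =
      if r = s ∧ i = j then star (u i) * u j else 0 := by
    intro i j
    rw [mul_assoc, ← mul_assoc (star (L r i)), hL]
    split_ifs <;> simp
  simp only [star_sum, star_mul, Finset.sum_mul_sum, h]
  by_cases hrs : r = s <;> simp [hrs]

theorem aux_norm {C : Type*} [CStarAlgebra C] {n : ℕ} (u : Fin n → C) :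
    ‖∑ i, star (u i) * u i‖ ≤ ∑ i, ‖u i‖ ^ 2 :=
  (norm_sum_le _ _).trans (by simp [CStarRing.norm_star_mul_self, sq])

theorem aux_col_norm {C : Type*} [CStarAlgebra C] {n R : ℕ} (L : Fin R → Fin n → C)
    (hL : ∀ r s i j, star (L r i) * L s j = if r = s ∧ i = j then 1 else 0) (u : Fin n → C)
    (r : Fin R) : ‖∑ i, L r i * u i‖ ^ 2 ≤ ∑ i, ‖u i‖ ^ 2 := by
  rw [sq, ← CStarRing.norm_star_mul_self, aux_col L hL]
  simpa using aux_norm u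

theorem aux_main {C : Type*} [CStarAlgebra C] {n R : ℕ} (hR : 0 < R) (L : Fin R → Fin n → C)
    (hL : ∀ r s i j, star (L r i) * L s j = if r = s ∧ i = j then 1 else 0) (u v : Fin n → C)
    (hv : ∀ r i j, star (L r i) * v j = v j * star (L r i)) (S : ℝ) (hS : 0 ≤ S)
    (huS : ∑ i, ‖u i‖ ^ 2 ≤ S) (hvS : ∑ i, ‖v i‖ ^ 2 ≤ S) :
    ‖∑ r, (∑ i, L r i * u i) * (∑ j, L r j * v j)‖ ≤ Real.sqrt R * S ∧
    ‖∑ r, (∑ i, L r i * u i) * (∑ j, star (L r j) * v j)‖ =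
      ⨆ r : Fin R, ‖(∑ i, L r i * u i) * (∑ j, star (L r j) * v j)‖ ∧
    ‖∑ r, (∑ i, L r i * u i) * (∑ j, star (L r j) * v j)‖ ≤ S := by
  have : Nonempty (Fin R) := ⟨⟨0, hR⟩⟩
  have hW : ∀ r, ∑ j, star (L r j) * v j = star (∑ j, L r j * star (v j)) := by
    intro r
    simp [star_sum, star_mul, hv]
  have hX : ∀ r, ‖∑ i, L r i * u i‖ ^ 2 ≤ S := fun r => (aux_col_norm L hL u r).trans huS
  have hY : ∀ r, ‖∑ i, L r i * v i‖ ^ 2 ≤ S := fun r => (aux_col_norm L hL v r).trans hvS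
  have hWn : ∀ r, ‖∑ j, star (L r j) * v j‖ ^ 2 ≤ S := by
    intro r
    rw [hW, norm_star]
    refine (aux_col_norm L hL (fun j => star (v j)) r).trans ?_
    simpa using hvS
  have hXX := aux_col L hL u
  have hWW : ∀ r s, r ≠ s →
      (∑ j, star (L r j) * v j) * star (∑ j, star (L s j) * v j) = 0 := by
    intro r s hrs
    rw [hW, hW, star_star, aux_col L hL (fun j => star (v j)), if_neg hrs]
  generalize hXd : (fun r => ∑ i, L r i * u i) = X at *
  generalize hYd : (fun r => ∑ i, L r i * v i) = Y at *
  generalize hWd : (fun r => ∑ j, star (L r j) * v j) = W at *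
  have eX : ∀ r, ∑ i, L r i * u i = X r := fun r => congrFun hXd r
  have eY : ∀ r, ∑ i, L r i * v i = Y r := fun r => congrFun hYd r
  have eW : ∀ r, ∑ i, star (L r i) * v i = W r := fun r => congrFun hWd r
  simp only [eX, eY, eW] at *
  have hsup := aux_norm_sum hR (fun r => X r * W r)
    (fun r s hrs => by
      rw [star_mul, mul_assoc, ← mul_assoc (star (X r)), hXX, if_neg hrs, zero_mul, mul_zero])
    (fun r s hrs => by
      rw [star_mul, mul_assoc, ← mul_assoc (W r), hWW r s hrs, zero_mul, mul_zero])
  refine ⟨?_, hsup, ?_⟩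
  · refine abs_le_of_sq_le_sq' ?_ (by positivity) |>.2
    rw [mul_pow, Real.sq_sqrt (by positivity), sq, ← CStarRing.norm_star_mul_self]
    have hZ : star (∑ r, X r * Y r) * (∑ r, X r * Y r) =
        ∑ r, star (Y r) * (∑ i, star (u i) * u i) * Y r := by
      rw [star_sum, Finset.sum_mul]
      refine Finset.sum_congr rfl fun r _ => ?_
      rw [Finset.mul_sum, Finset.sum_eq_single r]
      · rw [star_mul, mul_assoc, ← mul_assoc (star (X r)), hXX, if_pos rfl, mul_assoc]
      · intro s _ hs
        rw [star_mul, mul_assoc, ← mul_assoc (star (X r)), hXX, if_neg hs.symm, zero_mul, mul_zero]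
      · simp
    rw [hZ]
    refine (norm_sum_le _ _).trans ((Finset.sum_le_card_nsmul _ _ (S ^ 2) ?_).trans (by simp))
    intro r _
    have hβ := (aux_norm u).trans huS
    calc _ ≤ ‖star (Y r)‖ * ‖∑ i, star (u i) * u i‖ * ‖Y r‖ :=
          (norm_mul_le _ _).trans (by gcongr; exact norm_mul_le _ _)
      _ = ‖∑ i, star (u i) * u i‖ * ‖Y r‖ ^ 2 := by rw [norm_star]; ring
      _ ≤ S * S := mul_le_mul hβ (hY r) (by positivity) hS
      _ = S ^ 2 := by ring
  · rw [hsup]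
    refine ciSup_le fun r => (norm_mul_le _ _).trans ?_
    nlinarith [hX r, hWn r, sq_nonneg (‖X r‖ - ‖W r‖)]

/-- for isometries `l r i` with mutually orthogonal ranges
(`l r i * l s j = δ_{ij} δ_{rs} 1` after applying `star` to the first factor) in a
unital C*-algebra `B`, and elements `b i, c i` of a C*-algebra `A` with `‖b i‖ = ‖c i‖`,
inside a common C*-algebra `C` containing commuting isometric copies of `B` and `A`
(as in the minimal tensor product):
`‖∑_{r,i,j} l_i(r) l_j(r) ⊗ b_i c_j‖ ≤ √R ∑ᵢ ‖bᵢ‖‖cᵢ‖` and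
`‖∑_{r,i,j} l_i(r) l_j(r)* ⊗ b_i c_j‖ = max_r ‖∑_{i,j} l_i(r) l_j(r)* ⊗ b_i c_j‖
  ≤ ∑ᵢ ‖bᵢ‖‖cᵢ‖`. -/
theorem stmt6 {B A C : Type*} [CStarAlgebra B] [CStarAlgebra A] [CStarAlgebra C]
    (φ : B →⋆ₐ[ℂ] C) (ψ : A →⋆ₐ[ℂ] C)
    (hcomm : ∀ (x : B) (a : A), φ x * ψ a = ψ a * φ x)
    (hφ_inj : Function.Injective φ) (hψ_inj : Function.Injective ψ)
    {n R : ℕ} (hR : 0 < R) (l : Fin R → Fin n → B)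
    (hl : ∀ r s i j, star (l r i) * l s j = if r = s ∧ i = j then 1 else 0)
    (b c : Fin n → A) (hbc : ∀ i, ‖b i‖ = ‖c i‖) :
    ‖∑ r, ∑ i, ∑ j, φ (l r i * l r j) * ψ (b i * c j)‖ ≤
        Real.sqrt R * ∑ i, ‖b i‖ * ‖c i‖ ∧
    ‖∑ r, ∑ i, ∑ j, φ (l r i * star (l r j)) * ψ (b i * c j)‖ =
        ⨆ r : Fin R, ‖∑ i, ∑ j, φ (l r i * star (l r j)) * ψ (b i * c j)‖ ∧
    ‖∑ r, ∑ i, ∑ j, φ (l r i * star (l r j)) * ψ (b i * c j)‖ ≤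
        ∑ i, ‖b i‖ * ‖c i‖ := by
  have hψ : ∀ a, ‖ψ a‖ ≤ ‖a‖ := fun a => NonUnitalStarAlgHom.norm_apply_le ψ a
  have hsq : ∀ i, ‖b i‖ * ‖c i‖ = ‖b i‖ ^ 2 := fun i => by rw [← hbc, sq]
  have h1 : ∀ r, ∑ i, ∑ j, φ (l r i * l r j) * ψ (b i * c j) =
      (∑ i, φ (l r i) * ψ (b i)) * (∑ j, φ (l r j) * ψ (c j)) := by
    intro r
    rw [Finset.sum_mul_sum]
    refine Finset.sum_congr rfl fun i _ => Finset.sum_congr rfl fun j _ => ?_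
    rw [map_mul, map_mul, mul_assoc, mul_assoc, ← mul_assoc (φ (l r j)), hcomm, mul_assoc]
  have h2 : ∀ r, ∑ i, ∑ j, φ (l r i * star (l r j)) * ψ (b i * c j) =
      (∑ i, φ (l r i) * ψ (b i)) * (∑ j, star (φ (l r j)) * ψ (c j)) := by
    intro r
    rw [Finset.sum_mul_sum]
    refine Finset.sum_congr rfl fun i _ => Finset.sum_congr rfl fun j _ => ?_
    rw [map_mul, map_mul, ← map_star, mul_assoc, mul_assoc, ← mul_assoc (φ (star (l r j))), hcomm,
      mul_assoc]
  simp only [h1, h2]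
  refine aux_main hR (fun r i => φ (l r i)) ?_ (fun i => ψ (b i)) (fun i => ψ (c i)) ?_ _ ?_ ?_ ?_
  · intro r s i j
    rw [← map_star, ← map_mul, hl]
    split_ifs <;> simp
  · intro r i j
    rw [← map_star, hcomm]
  · positivity
  · refine Finset.sum_le_sum fun i _ => ?_
    rw [hsq]
    exact pow_le_pow_left₀ (norm_nonneg _) (hψ _) 2
  · refine Finset.sum_le_sum fun i _ => ?_
    rw [hsq, hbc]
    exact pow_le_pow_left₀ (norm_nonneg _) (hψ _) 2
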